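/- arXiv:2204.04011 — 2 statements merged into one kernel-verified Lean document; each statement's English description precedes it below -/
import Mathlib

section
/- Let H ∈ ℚ[[X]] be the formal power series H(X) = ∑_{n=0}^{∞} h(n) X^n, where h = h_{1,1}. Then H is transcendental over the subring ℚ[X] of polynomials (embedded in ℚ[[X]] in the canonical way); equivalently, H is transcendental over the rational function field ℚ(X). -/
/-- `f` converges absolutely at `x` with value `v`. -/
def EvalsTo (x : ℝ) (f : PowerSeries ℚ) (v : ℝ) : Prop :=
  Summable (fun n => ‖((PowerSeries.coeff n f : ℚ) : ℝ) * x ^ n‖) ∧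
    HasSum (fun n => ((PowerSeries.coeff n f : ℚ) : ℝ) * x ^ n) v

theorem EvalsTo.add {x : ℝ} {f g : PowerSeries ℚ} {v w : ℝ} (hf : EvalsTo x f v)
    (hg : EvalsTo x g w) : EvalsTo x (f + g) (v + w) := by
  constructor
  · refine Summable.of_nonneg_of_le (fun _ => norm_nonneg _) (fun n => ?_) (hf.1.add hg.1)
    rw [map_add, Rat.cast_add, add_mul]
    exact norm_add_le _ _
  · have := hf.2.add hg.2
    refine this.congr_fun ?_ <;> simp [add_mul]

theorem EvalsTo.mul {x : ℝ} {f g : PowerSeries ℚ} {v w : ℝ} (hf : EvalsTo x f v)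
    (hg : EvalsTo x g w) : EvalsTo x (f * g) (v * w) := by
  have key : ∀ n, ((PowerSeries.coeff n (f * g) : ℚ) : ℝ) * x ^ n =
      ∑ kl ∈ Finset.HasAntidiagonal.antidiagonal n, (((PowerSeries.coeff kl.1 f : ℚ) : ℝ) * x ^ kl.1) *
        (((PowerSeries.coeff kl.2 g : ℚ) : ℝ) * x ^ kl.2) := by
    intro n
    rw [PowerSeries.coeff_mul, Rat.cast_sum, Finset.sum_mul]
    refine Finset.sum_congr rfl fun kl hkl => ?_
    rw [← Finset.HasAntidiagonal.mem_antidiagonal.1 hkl, pow_add]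
    push_cast
    ring
  have hs := summable_norm_sum_mul_antidiagonal_of_summable_norm hf.1 hg.1
  have ht := tsum_mul_tsum_eq_tsum_sum_antidiagonal_of_summable_norm hf.1 hg.1
  rw [hf.2.tsum_eq, hg.2.tsum_eq] at ht
  unfold EvalsTo
  simp only [key]
  refine ⟨hs, ?_⟩
  rw [ht]
  exact hs.of_norm.hasSum

theorem EvalsTo.poly (x : ℝ) (p : Polynomial ℚ) :
    EvalsTo x (p : PowerSeries ℚ) (Polynomial.aeval x p) := by
  have hz : ∀ n ∉ Finset.range (p.natDegree + 1),
      ((PowerSeries.coeff n (p : PowerSeries ℚ) : ℚ) : ℝ) * x ^ n = 0 := by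
    intro n hn
    rw [Polynomial.coeff_coe, Polynomial.coeff_eq_zero_of_natDegree_lt]
    · simp
    · have := mt Finset.mem_range.2 hn
      omega
  constructor
  · exact summable_of_ne_finset_zero (s := Finset.range (p.natDegree + 1))
      (fun n hn => by rw [hz n hn, norm_zero])
  · have := hasSum_sum_of_ne_finset_zero (L := SummationFilter.unconditional ℕ) hz
    convert this using 1
    rw [Polynomial.aeval_eq_sum_range]
    refine Finset.sum_congr rfl fun n _ => ?_
    rw [Polynomial.coeff_coe, Algebra.smul_def]
    rfl

theorem EvalsTo.one (x : ℝ) : EvalsTo x 1 1 := by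
  simpa using EvalsTo.poly x 1

theorem EvalsTo.zero (x : ℝ) : EvalsTo x 0 0 := by
  simpa using EvalsTo.poly x 0

theorem EvalsTo.pow {x : ℝ} {f : PowerSeries ℚ} {v : ℝ} (hf : EvalsTo x f v) (n : ℕ) :
    EvalsTo x (f ^ n) (v ^ n) := by
  induction n with
  | zero => simpa using EvalsTo.one x
  | succ k ih => rw [pow_succ, pow_succ]; exact ih.mul hf

theorem EvalsTo.sum {x : ℝ} (F : ℕ → PowerSeries ℚ) (V : ℕ → ℝ)
    (hF : ∀ i, EvalsTo x (F i) (V i)) (n : ℕ) :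
    EvalsTo x (∑ i ∈ Finset.range n, F i) (∑ i ∈ Finset.range n, V i) := by
  induction n with
  | zero => simpa using EvalsTo.zero x
  | succ k ih => rw [Finset.sum_range_succ, Finset.sum_range_succ]; exact ih.add (hF k)

/-- An algebraic relation for a power series specializes at points of convergence. -/
theorem eval_relation {x v : ℝ} {f : PowerSeries ℚ} (hf : EvalsTo x f v)
    (P : Polynomial (Polynomial ℚ)) (hP : Polynomial.aeval f P = 0) :
    ∑ i ∈ Finset.range (P.natDegree + 1), (Polynomial.aeval x (P.coeff i)) * v ^ i = 0 := by
  have h1 := EvalsTo.sum (x := x) (fun i => (P.coeff i : PowerSeries ℚ) * f ^ i)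
    (fun i => (Polynomial.aeval x (P.coeff i)) * v ^ i)
    (fun i => (EvalsTo.poly x _).mul (hf.pow i)) (P.natDegree + 1)
  have h2 : ∑ i ∈ Finset.range (P.natDegree + 1), (P.coeff i : PowerSeries ℚ) * f ^ i = 0 := by
    rw [← hP, Polynomial.aeval_eq_sum_range]
    refine Finset.sum_congr rfl fun n _ => ?_
    rw [Algebra.smul_def]
    rfl
  simp only [h2] at h1
  exact h1.2.unique (EvalsTo.zero x).2

/-- Algebraic functions grow at most polynomially, in the multiplied form. -/
theorem leading_bound (P : Polynomial (Polynomial ℚ)) :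
    ∃ B : ℝ, ∀ x v : ℝ, 0 < x → x < 1 → 1 ≤ v →
      ∑ i ∈ Finset.range (P.natDegree + 1), (Polynomial.aeval x (P.coeff i)) * v ^ i = 0 →
      |Polynomial.aeval x P.leadingCoeff| * v ≤ B := by
  have hb : ∀ q : Polynomial ℚ, ∃ b : ℝ, ∀ x ∈ Set.Icc (0:ℝ) 1, |Polynomial.aeval x q| ≤ b := by
    intro q
    obtain ⟨b, hb⟩ := (isCompact_Icc (a := (0:ℝ)) (b := 1)).exists_bound_of_continuousOn
      (f := fun x : ℝ => Polynomial.aeval x q) (Polynomial.continuous_aeval q).continuousOn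
    exact ⟨b, fun x hx => by simpa using hb x hx⟩
  choose b hb using hb
  refine ⟨∑ i ∈ Finset.range P.natDegree, b (P.coeff i), fun x v hx0 hx1 hv hs => ?_⟩
  have hxI : x ∈ Set.Icc (0:ℝ) 1 := ⟨hx0.le, hx1.le⟩
  have hv0 : 0 < v := by linarith
  rw [Finset.sum_range_succ] at hs
  have h1 : |Polynomial.aeval x P.leadingCoeff| * v ^ P.natDegree =
      |∑ i ∈ Finset.range P.natDegree, (Polynomial.aeval x (P.coeff i)) * v ^ i| := by
    rw [← abs_of_pos (pow_pos hv0 P.natDegree), ← abs_mul, Polynomial.leadingCoeff,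
      eq_neg_of_add_eq_zero_left hs, abs_neg]
  have h2 : |∑ i ∈ Finset.range P.natDegree, (Polynomial.aeval x (P.coeff i)) * v ^ i| * v ≤
      (∑ i ∈ Finset.range P.natDegree, b (P.coeff i)) * v ^ P.natDegree := by
    refine (mul_le_mul_of_nonneg_right (Finset.abs_sum_le_sum_abs _ _) hv0.le).trans ?_
    rw [Finset.sum_mul, Finset.sum_mul]
    refine Finset.sum_le_sum fun i hi => ?_
    rw [abs_mul, abs_of_pos (pow_pos hv0 i), mul_assoc, ← pow_succ]
    exact mul_le_mul (hb _ x hxI) (pow_le_pow_right₀ hv (Finset.mem_range.1 hi))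
      (by positivity) ((abs_nonneg _).trans (hb _ x hxI))
  have hpos := pow_pos hv0 P.natDegree
  refine le_of_mul_le_mul_right ?_ hpos
  calc _ = |Polynomial.aeval x P.leadingCoeff| * v ^ P.natDegree * v := by ring
    _ ≤ _ := by rw [h1]; exact h2

/-- A nonzero polynomial vanishes at `1` to finite order. -/
theorem poly_lower (q : Polynomial ℚ) (hq : q ≠ 0) :
    ∃ (m : ℕ) (c : ℝ), 0 < c ∧ ∀ᶠ x in nhdsWithin (1:ℝ) (Set.Iio 1),
      c * (1 - x) ^ m ≤ |Polynomial.aeval x q| := by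
  obtain ⟨r, hr, hr1⟩ := Polynomial.exists_eq_pow_rootMultiplicity_mul_and_not_dvd q hq 1
  have hr2 : Polynomial.aeval (1:ℝ) r ≠ 0 := by
    intro h
    apply hr1
    rw [Polynomial.dvd_iff_isRoot, Polynomial.IsRoot]
    have := Polynomial.aeval_algebraMap_apply ℝ (1:ℚ) r
    rw [map_one, h] at this
    simpa using this.symm
  refine ⟨q.rootMultiplicity 1, |Polynomial.aeval (1:ℝ) r| / 2, by positivity, ?_⟩
  have hc : Filter.Tendsto (fun x : ℝ => |Polynomial.aeval x r|) (nhds 1)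
      (nhds |Polynomial.aeval (1:ℝ) r|) :=
    ((Polynomial.continuous_aeval r).abs).tendsto 1
  have he := hc.eventually_const_le (u := |Polynomial.aeval (1:ℝ) r| / 2)
    (by have := abs_pos.2 hr2; linarith)
  filter_upwards [he.filter_mono nhdsWithin_le_nhds, self_mem_nhdsWithin] with x hx hx1
  have hx1 : x < 1 := hx1
  have h3 : |Polynomial.aeval x q| = (1 - x) ^ (q.rootMultiplicity 1) * |Polynomial.aeval x r| := by
    conv_lhs => rw [hr]
    rw [map_mul, map_pow, abs_mul, abs_pow]
    congr 2
    simp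
    rw [abs_of_neg (by linarith)]
    ring
  rw [h3, mul_comm]
  exact mul_le_mul_of_nonneg_left hx (pow_nonneg (by linarith) _)

/-- Closed form at odd arguments and the recursion at even arguments. -/
theorem seq_facts (h : ℤ → ℕ)
    (hinit : ∀ n : ℤ, n ≤ 1 → h n = 1)
    (hrec : ∀ n : ℤ, 2 ≤ n → h n = h (n - (h (n - 1) : ℤ)) + h (n - 2)) :
    (∀ n, 1 ≤ h n) ∧ (∀ k : ℕ, h (2 * k + 1) = k + 1) ∧
      (∀ k : ℕ, h (2 * k + 2) = h (2 * k) + h (k + 1)) := by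
  have hposN : ∀ n : ℕ, 1 ≤ h n ∧ 1 ≤ h (n + 1) := by
    intro n
    induction n with
    | zero => constructor <;> rw [hinit] <;> norm_num
    | succ k ih =>
      refine ⟨by exact_mod_cast ih.2, ?_⟩
      have := hrec ((k + 1 : ℕ) + 1) (by push_cast; omega)
      have e : (((k + 1 : ℕ) : ℤ) + 1 - 2) = k := by push_cast; ring
      rw [e] at this
      omega
  have hpos : ∀ n, 1 ≤ h n := by
    intro n
    rcases le_or_gt n 1 with hn | hn
    · rw [hinit n hn]
    · lift n to ℕ using by omega
      exact (hposN n).1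
  have h2 : ∀ n : ℤ, 2 ≤ n → 2 ≤ h n := by
    intro n hn
    rw [hrec n hn]
    have := hpos (n - (h (n - 1) : ℤ))
    have := hpos (n - 2)
    omega
  have heven : ∀ k : ℕ, h (2 * k + 1) = k + 1 → h (2 * k + 2) = h (2 * k) + h (k + 1) := by
    intro k hk
    rw [hrec (2 * k + 2) (by omega)]
    have e1 : (2 * (k:ℤ) + 2 - 1) = 2 * k + 1 := by ring
    have e2 : (2 * (k:ℤ) + 2 - 2) = 2 * k := by ring
    rw [e1, e2, hk]
    have e3 : (2 * (k:ℤ) + 2 - ((k + 1 : ℕ) : ℤ)) = k + 1 := by push_cast; ring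
    rw [e3, add_comm]
  have main : ∀ k : ℕ, h (2 * k + 1) = k + 1 ∧ 2 * k ≤ h (2 * k) := by
    intro k
    induction k with
    | zero => exact ⟨by rw [hinit] <;> norm_num, by simp⟩
    | succ k ih =>
      have he := heven k ih.1
      have hge : 2 * (k + 1) ≤ h (2 * k + 2) := by
        rcases Nat.eq_zero_or_pos k with rfl | hk
        · exact h2 _ (by norm_num)
        · have := h2 (k + 1) (by omega)
          omega
      have ec : (2 * ((k + 1 : ℕ) : ℤ)) = 2 * k + 2 := by push_cast; ring
      rw [ec]
      refine ⟨?_, hge⟩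
      rw [hrec (2 * k + 2 + 1) (by omega)]
      have e1 : (2 * (k:ℤ) + 2 + 1 - 1) = 2 * k + 2 := by ring
      have e2 : (2 * (k:ℤ) + 2 + 1 - 2) = 2 * k + 1 := by ring
      rw [e1, e2, ih.1, hinit _ (by omega)]
      omega
  exact ⟨hpos, fun k => (main k).1, fun k => heven k (main k).1⟩

/-- The sequence grows subexponentially. -/
theorem subexp (g : ℕ → ℕ) (hg : ∀ n, g (n + 2) ≤ g n + g ((n + 2) / 2)) (r : ℝ) (hr : 1 < r) :
    ∃ C : ℝ, ∀ n, (g n : ℝ) ≤ C * r ^ n := by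
  have hr2 : 0 < r ^ 2 - 1 := by nlinarith
  obtain ⟨N, hN⟩ := pow_unbounded_of_one_lt (1 / (r ^ 2 - 1)) hr
  have hN' : 1 ≤ r ^ N * (r ^ 2 - 1) := by
    rw [div_lt_iff₀ hr2] at hN
    exact hN.le
  refine ⟨∑ i ∈ Finset.range (2 * N + 4), (g i : ℝ), fun n => ?_⟩
  set C : ℝ := ∑ i ∈ Finset.range (2 * N + 4), (g i : ℝ) with hC
  have hC0 : 0 ≤ C := Finset.sum_nonneg fun i _ => Nat.cast_nonneg _
  induction n using Nat.strong_induction_on with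
  | _ n ih =>
    rcases lt_or_ge n (2 * N + 4) with hn | hn
    · have h1 : (g n : ℝ) ≤ C :=
        Finset.single_le_sum (f := fun i => (g i : ℝ)) (fun i _ => Nat.cast_nonneg _)
          (Finset.mem_range.2 hn)
      have h2 : (1:ℝ) ≤ r ^ n := one_le_pow₀ hr.le
      nlinarith
    · obtain ⟨m, rfl⟩ : ∃ m, n = m + 2 := ⟨n - 2, by omega⟩
      have h1 : (g (m + 2) : ℝ) ≤ g m + g ((m + 2) / 2) := by exact_mod_cast hg m
      have h2 := ih m (by omega)
      have h3 := ih ((m + 2) / 2) (by omega)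
      have h4 : r ^ ((m + 2) / 2) * r ^ N ≤ r ^ m := by
        rw [← pow_add]
        exact pow_le_pow_right₀ hr.le (by omega)
      have h5 : 0 < r ^ ((m + 2) / 2) := by positivity
      have h6 : r ^ ((m + 2) / 2) ≤ r ^ m * (r ^ 2 - 1) := by
        calc r ^ ((m + 2) / 2) ≤ r ^ ((m + 2) / 2) * (r ^ N * (r ^ 2 - 1)) :=
              le_mul_of_one_le_right h5.le hN'
          _ = r ^ ((m + 2) / 2) * r ^ N * (r ^ 2 - 1) := by ring
          _ ≤ _ := mul_le_mul_of_nonneg_right h4 hr2.le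
      have h7 : C * r ^ ((m + 2) / 2) ≤ C * (r ^ m * (r ^ 2 - 1)) :=
        mul_le_mul_of_nonneg_left h6 hC0
      calc (g (m + 2) : ℝ) ≤ C * r ^ m + C * (r ^ m * (r ^ 2 - 1)) := by linarith
        _ = C * r ^ (m + 2) := by ring

/-- Convergence inside the unit disc. -/
theorem conv (g : ℕ → ℕ) (hg : ∀ n, g (n + 2) ≤ g n + g ((n + 2) / 2)) (x : ℝ) (hx0 : 0 < x)
    (hx1 : x < 1) : Summable (fun n => (g n : ℝ) * x ^ n) := by
  obtain ⟨y, hy1, hy2⟩ := exists_between hx1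
  have hy0 : 0 < y := hx0.trans hy1
  obtain ⟨C, hC⟩ := subexp g hg y⁻¹ ((one_lt_inv₀ hy0).2 hy2)
  have hs : Summable (fun n : ℕ => C * (x / y) ^ n) :=
    (summable_geometric_of_lt_one (by positivity) ((div_lt_one hy0).2 hy1)).mul_left C
  refine Summable.of_nonneg_of_le (fun n => by positivity) (fun n => ?_) hs
  calc (g n : ℝ) * x ^ n ≤ C * y⁻¹ ^ n * x ^ n :=
        mul_le_mul_of_nonneg_right (hC n) (by positivity)
    _ = C * (x / y) ^ n := by rw [mul_assoc, ← mul_pow, div_eq_inv_mul]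

/-- The Mahler-type functional inequality. -/
theorem mahler_ineq (g : ℕ → ℕ) (g0 : g 0 = 1) (he : ∀ k, g (2 * (k + 1)) = g (2 * k) + g (k + 1))
    (hs : ∀ x : ℝ, 0 < x → x < 1 → Summable (fun n => (g n : ℝ) * x ^ n))
    (x : ℝ) (hx0 : 0 < x) (hx1 : x < 1) :
    ∑' n, (g n : ℝ) * (x ^ 2) ^ n ≤ (1 - x ^ 2) * ∑' n, (g n : ℝ) * x ^ n := by
  have hinj : Function.Injective (fun k : ℕ => 2 * k) := fun a b hab => by
    have : 2 * a = 2 * b := hab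
    omega
  have hsx := hs x hx0 hx1
  have hsx2 := hs (x ^ 2) (by positivity) (by nlinarith)
  have hA : Summable (fun k => (g (2 * k) : ℝ) * (x ^ 2) ^ k) := by
    have := hsx.comp_injective hinj
    refine this.congr fun k => ?_
    simp [pow_mul]
  have hle : ∑' k, (g (2 * k) : ℝ) * (x ^ 2) ^ k ≤ ∑' n, (g n : ℝ) * x ^ n := by
    refine hA.tsum_le_tsum_of_inj (fun k : ℕ => 2 * k) hinj (fun c _ => by positivity)
      (fun k => ?_) hsx
    simp [pow_mul]
  have e1 := hA.tsum_eq_zero_add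
  have e2 := hsx2.tsum_eq_zero_add
  have hA' := hA.mul_left (x ^ 2)
  have hB' : Summable (fun k => (g (k + 1) : ℝ) * (x ^ 2) ^ (k + 1)) :=
    (summable_nat_add_iff 1).2 hsx2
  have e3 : ∑' k, (g (2 * (k + 1)) : ℝ) * (x ^ 2) ^ (k + 1) =
      x ^ 2 * (∑' k, (g (2 * k) : ℝ) * (x ^ 2) ^ k) +
        ∑' k, (g (k + 1) : ℝ) * (x ^ 2) ^ (k + 1) := by
    rw [← tsum_mul_left, ← hA'.tsum_add hB']
    refine tsum_congr fun k => ?_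
    rw [he]
    push_cast
    ring
  rw [e3] at e1
  simp only [mul_zero, g0] at e1 e2
  have hx2 : 0 ≤ 1 - x ^ 2 := by nlinarith
  refine le_trans (le_of_eq ?_) (mul_le_mul_of_nonneg_left hle hx2)
  linarith

/-- Superpolynomial growth near `1`. -/
theorem growth (F : ℝ → ℝ) (h1 : ∀ x, 0 < x → x < 1 → 1 ≤ F x)
    (hF : ∀ x, 0 < x → x < 1 → F (x ^ 2) ≤ (1 - x ^ 2) * F x) (m : ℕ) :
    ∃ c : ℝ, 0 < c ∧ ∀ x, 0 < x → x < 1 → c ≤ (1 - x) ^ m * F x := by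
  induction m with
  | zero => exact ⟨1, one_pos, fun x a b => by simpa using h1 x a b⟩
  | succ m ih =>
    obtain ⟨c, hc, hcx⟩ := ih
    refine ⟨c / 2 ^ (m + 1), by positivity, fun x a b => ?_⟩
    have h2 := hcx (x ^ 2) (by positivity) (by nlinarith)
    have hF0 : 0 < F x := by linarith [h1 x a b]
    rw [div_le_iff₀ (by positivity)]
    have hx2 : 0 ≤ 1 - x ^ 2 := by nlinarith
    calc c ≤ (1 - x ^ 2) ^ m * F (x ^ 2) := h2
      _ ≤ (1 - x ^ 2) ^ m * ((1 - x ^ 2) * F x) :=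
          mul_le_mul_of_nonneg_left (hF x a b) (by positivity)
      _ = (1 - x ^ 2) ^ (m + 1) * F x := by ring
      _ ≤ (2 * (1 - x)) ^ (m + 1) * F x := by
          refine mul_le_mul_of_nonneg_right (pow_le_pow_left₀ hx2 (by nlinarith) _) hF0.le
      _ = _ := by rw [mul_pow]; ring

/-- The generating function `H(X) = ∑ h(n) Xⁿ`, viewed as an element of
`ℚ[[X]]`, is transcendental over the subring `ℚ[X]` of polynomials (with its
canonical embedding into `ℚ[[X]]`), where `h = h_{1,1}`. -/
theorem stmt6 (h : ℤ → ℕ)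
    (hinit : ∀ n : ℤ, n ≤ 1 → h n = 1)
    (hrec : ∀ n : ℤ, 2 ≤ n → h n = h (n - (h (n - 1) : ℤ)) + h (n - 2)) :
    Transcendental (Polynomial ℚ)
      (PowerSeries.mk (fun n : ℕ => (h n : ℚ)) : PowerSeries ℚ) := by
  obtain ⟨hpos, hodd, heven⟩ := seq_facts h hinit hrec
  set g : ℕ → ℕ := fun n => h n with hgdef
  have g0 : g 0 = 1 := hinit _ (by norm_num)
  have godd : ∀ k, g (2 * k + 1) = k + 1 := fun k => by
    have := hodd k
    simpa [hgdef] using this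
  have geven : ∀ k, g (2 * (k + 1)) = g (2 * k) + g (k + 1) := fun k => by
    have := heven k
    simp only [hgdef]
    push_cast
    rw [mul_add, mul_one]
    exact this
  have gpos : ∀ n, 1 ≤ g n := fun n => hpos n
  have hg : ∀ n, g (n + 2) ≤ g n + g ((n + 2) / 2) := by
    intro n
    rcases Nat.even_or_odd' n with ⟨k, rfl | rfl⟩
    · have e : (2 * k + 2) / 2 = k + 1 := by omega
      rw [e]
      exact (geven k).le
    · have e : 2 * k + 1 + 2 = 2 * (k + 1) + 1 := by ring
      have := gpos ((2 * k + 1 + 2) / 2)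
      have h1 := godd k
      have h2 := godd (k + 1)
      rw [← e] at h2
      omega
  have hs := conv g hg
  set F : ℝ → ℝ := fun x => ∑' n, (g n : ℝ) * x ^ n with hFdef
  have hF1 : ∀ x, 0 < x → x < 1 → 1 ≤ F x := by
    intro x a b
    have := (hs x a b).le_tsum 0 (fun j _ => by positivity)
    simpa [g0] using this
  have hE : ∀ x, 0 < x → x < 1 →
      EvalsTo x (PowerSeries.mk (fun n : ℕ => (h n : ℚ))) (F x) := by
    intro x a b
    have e : (fun n => ((PowerSeries.coeff n (PowerSeries.mk (fun n : ℕ => (h n : ℚ))) : ℚ) : ℝ)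
        * x ^ n) = fun n => (g n : ℝ) * x ^ n := by
      funext n
      simp [hgdef]
    unfold EvalsTo
    rw [e]
    exact ⟨(hs x a b).norm.congr (fun n => by simp [hgdef]), (hs x a b).hasSum⟩
  rintro ⟨P, hP0, hP⟩
  obtain ⟨B, hB⟩ := leading_bound P
  obtain ⟨m, c, hc, hlow⟩ := poly_lower P.leadingCoeff (Polynomial.leadingCoeff_ne_zero.2 hP0)
  obtain ⟨c', hc', hgrow⟩ := growth F hF1 (fun x a b => mahler_ineq g g0 geven hs x a b) (m + 1)
  have hlim : Filter.Tendsto (fun x : ℝ => B * (1 - x)) (nhdsWithin (1:ℝ) (Set.Iio 1)) (nhds 0) := by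
    have : Continuous (fun x : ℝ => B * (1 - x)) := by fun_prop
    have h2 := this.tendsto 1
    simp only [sub_self, mul_zero] at h2
    exact h2.mono_left nhdsWithin_le_nhds
  have hsmall := hlim.eventually_lt_const (u := c * c') (by positivity)
  have hx0 : ∀ᶠ x in nhdsWithin (1:ℝ) (Set.Iio 1), 0 < x :=
    (lt_mem_nhds one_pos).filter_mono nhdsWithin_le_nhds
  obtain ⟨x, ⟨⟨h1, h2⟩, h3⟩, h4⟩ :=
    (((hlow.and hsmall).and hx0).and (self_mem_nhdsWithin (a := (1:ℝ)) (s := Set.Iio 1))).exists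
  have h4 : x < 1 := h4
  have h5 := hB x (F x) h3 h4 (hF1 x h3 h4) (eval_relation (hE x h3 h4) P hP)
  have h6 := hgrow x h3 h4
  have h7 : 0 < F x := by linarith [hF1 x h3 h4]
  have : c * c' ≤ B * (1 - x) := by
    calc c * c' ≤ c * ((1 - x) ^ (m + 1) * F x) := mul_le_mul_of_nonneg_left h6 hc.le
      _ = (c * (1 - x) ^ m) * F x * (1 - x) := by ring
      _ ≤ |Polynomial.aeval x P.leadingCoeff| * F x * (1 - x) :=
          mul_le_mul_of_nonneg_right (mul_le_mul_of_nonneg_right h1 h7.le) (by linarith)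
      _ ≤ B * (1 - x) := mul_le_mul_of_nonneg_right h5 (by linarith)
  linarith
end

section
/- Let b ≥ 2 be an integer and H_b(X) = ∑_{n=0}^{∞} h_{1,b}(n) X^n, viewed as an element of ℚ[[X]]. Then H_b is transcendental over the subring ℚ[X] of polynomials (embedded in ℚ[[X]] canonically); equivalently, H_b is transcendental over the rational function field ℚ(X). -/
open Polynomial in
lemma aux_roots (q : ℂ[X]) (hq : q ≠ 0)
    (hd : expand ℂ 2 q ∣ q * (X * (1 - X ^ 2))) :
    ∀ z : ℂ, q.eval z = 0 → z = 0 ∨ z = 1 := by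
  classical
  let S : Finset ℂ := q.roots.toFinset.filter (fun z => z ≠ 0 ∧ z ≠ 1)
  have memS : ∀ z, z ∈ S ↔ q.eval z = 0 ∧ z ≠ 0 ∧ z ≠ 1 := by
    intro z
    simp [S, hq]
  have key : ∀ w : ℂ, w ^ 2 ∈ S → w ∈ S := by
    intro w hw
    rw [memS] at hw ⊢
    obtain ⟨h1, h2, h3⟩ := hw
    obtain ⟨t, ht⟩ := hd
    have he := congrArg (Polynomial.eval w) ht
    simp only [eval_mul, eval_sub, eval_one, eval_pow, eval_X, expand_eval, h1, zero_mul] at he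
    have hw0 : w ≠ 0 := by
      rintro rfl
      simp at h2
    have hw1 : (1 : ℂ) - w ^ 2 ≠ 0 := fun h => h3 (by linear_combination -h)
    refine ⟨?_, hw0, ?_⟩
    · rcases mul_eq_zero.1 he with h | h
      · exact h
      · exact absurd h (mul_ne_zero hw0 hw1)
    · rintro rfl
      simp at hw1
  have hs : ∀ z : ℂ, ∃ w : ℂ, w ^ 2 = z := fun z => IsAlgClosed.exists_pow_nat_eq z two_pos
  choose f hf using hs
  have finj : Function.Injective f := fun a c h => by rw [← hf a, ← hf c, h]
  have himg : S.image f = S := by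
    apply Finset.eq_of_subset_of_card_le
    · intro w hw
      obtain ⟨z, hz, rfl⟩ := Finset.mem_image.1 hw
      exact key _ (by rw [hf]; exact hz)
    · rw [Finset.card_image_of_injective _ finj]
  intro z hz
  by_contra hcon
  push Not at hcon
  have hzS : z ∈ S := (memS z).2 ⟨hz, hcon⟩
  have hm : -f z ∈ S := key _ (by rw [neg_sq, hf]; exact hzS)
  rw [← himg] at hm
  obtain ⟨y, hy, hyz⟩ := Finset.mem_image.1 hm
  have h1 : y = z := by rw [← hf y, hyz, neg_sq, hf]
  subst h1
  have h2 : f y = 0 := by linear_combination hyz / 2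
  have := hf y
  rw [h2] at this
  exact hcon.1 (by rw [← this]; simp)

open Polynomial in
lemma aux_denom (q : ℂ[X]) (hq : q ≠ 0)
    (hd : expand ℂ 2 q ∣ q * (X * (1 - X ^ 2))) : q ∣ X * (X - 1) := by
  have hr := aux_roots q hq hd
  obtain ⟨q1, hq1, hn1⟩ := exists_eq_pow_rootMultiplicity_mul_and_not_dvd q hq 0
  generalize rootMultiplicity 0 q = s at hq1
  have hq10 : q1 ≠ 0 := by rintro rfl; simp at hn1
  obtain ⟨q2, hq2, hn2⟩ := exists_eq_pow_rootMultiplicity_mul_and_not_dvd q1 hq10 1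
  generalize rootMultiplicity 1 q1 = m at hq2
  have hdeg : q2.degree = 0 := by
    by_contra hcon
    obtain ⟨z, hz⟩ := IsAlgClosed.exists_root q2 hcon
    have hz' : q.eval z = 0 := by
      rw [hq1, hq2]; simp [hz.eq_zero]
    rcases hr z hz' with rfl | rfl
    · apply hn1
      rw [dvd_iff_isRoot, hq2, IsRoot, eval_mul, hz.eq_zero, mul_zero]
    · apply hn2
      rw [dvd_iff_isRoot]; exact hz
  obtain ⟨u, hu0, hu⟩ : ∃ u : ℂ, u ≠ 0 ∧ q2 = C u := by
    refine ⟨q2.coeff 0, ?_, eq_C_of_degree_eq_zero hdeg⟩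
    intro h
    rw [eq_C_of_degree_eq_zero hdeg, h] at hdeg
    simp at hdeg
  have hqf : q = X ^ s * ((X - 1) ^ m * C u) := by
    rw [hq1, hq2, hu]; simp
  have hCu : IsUnit (C u : ℂ[X]) := isUnit_C.2 (isUnit_iff_ne_zero.2 hu0)
  have hd2 : X ^ (2 * s) * (X + 1) ^ m * (X - 1) ^ m ∣
      (X ^ (s + 1) * ((X + 1) * (X - 1) ^ (m + 1)) : ℂ[X]) := by
    have h1 : expand ℂ 2 q = X ^ (2 * s) * (X + 1) ^ m * (X - 1) ^ m * C u := by
      rw [hqf]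
      simp only [map_mul, map_pow, map_sub, map_one, expand_X, expand_C]
      have : (X ^ 2 - 1 : ℂ[X]) = (X + 1) * (X - 1) := by ring
      rw [this, mul_pow]; ring
    have h2 : q * (X * (1 - X ^ 2)) = -(X ^ (s + 1) * ((X + 1) * (X - 1) ^ (m + 1))) * C u := by
      rw [hqf]; ring
    rw [h1, h2] at hd
    exact (dvd_neg.1 (hCu.mul_right_dvd.1 (hCu.dvd_mul_right.1 hd)))
  have cop : ∀ a c : ℂ, a ≠ c → IsCoprime (X - C a) (X - C c : ℂ[X]) := fun a c h =>
    isCoprime_X_sub_C_of_isUnit_sub (isUnit_iff_ne_zero.2 (sub_ne_zero.2 h))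
  have c1 : IsCoprime (X : ℂ[X]) (X + 1) := by simpa using cop 0 (-1) (by norm_num)
  have c2 : IsCoprime (X : ℂ[X]) (X - 1) := by simpa using cop 0 1 (by norm_num)
  have c3 : IsCoprime (X + 1 : ℂ[X]) (X - 1) := by simpa using cop (-1) 1 (by norm_num)
  have hs : s ≤ 1 := by
    have h1 : (X ^ (2 * s) : ℂ[X]) ∣ X ^ (s + 1) := by
      have h2 : (X ^ (2 * s) : ℂ[X]) ∣ X ^ (s + 1) * ((X + 1) * (X - 1) ^ (m + 1)) :=
        (Dvd.intro ((X + 1) ^ m * (X - 1) ^ m) (by ring)).trans hd2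
      exact IsCoprime.dvd_of_dvd_mul_right
        (IsCoprime.pow_left (c1.mul_right c2.pow_right)) h2
    have := (pow_dvd_pow_iff (X_ne_zero (R := ℂ)) not_isUnit_X).1 h1
    omega
  have hm : m ≤ 1 := by
    have h1 : ((X + 1) ^ m : ℂ[X]) ∣ (X + 1) ^ 1 := by
      have h2 : ((X + 1) ^ m : ℂ[X]) ∣ (X + 1) ^ 1 * (X ^ (s + 1) * (X - 1) ^ (m + 1)) := by
        refine (Dvd.intro (X ^ (2 * s) * (X - 1) ^ m) (by ring)).trans (hd2.trans (dvd_of_eq (by ring)))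
      exact IsCoprime.dvd_of_dvd_mul_right
        (IsCoprime.pow_left (c1.symm.pow_right.mul_right c3.pow_right)) h2
    have hx : (X + 1 : ℂ[X]) ≠ 0 := by simpa using X_sub_C_ne_zero (-1 : ℂ)
    have hx' : ¬ IsUnit (X + 1 : ℂ[X]) := by simpa using not_isUnit_X_sub_C (-1 : ℂ)
    exact (pow_dvd_pow_iff hx hx').1 h1
  rw [hqf, ← mul_assoc, hCu.mul_right_dvd]
  refine mul_dvd_mul ?_ ?_
  · simpa using pow_dvd_pow (X : ℂ[X]) hs
  · simpa using pow_dvd_pow (X - 1 : ℂ[X]) hm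

open Polynomial in
lemma aux_no_rat (c : ℂ) (p q : ℂ[X]) (hq : q ≠ 0) (hcop : IsCoprime p q)
    (E : (1 - X ^ 2) ^ 2 * p * expand ℂ 2 q = X * (1 - X ^ 2) * expand ℂ 2 p * q
      + (1 + C c * X * (1 - X ^ 2)) * q * expand ℂ 2 q) : False := by
  have hd : expand ℂ 2 q ∣ q * (X * (1 - X ^ 2)) := by
    have h1 : IsCoprime (expand ℂ 2 q) (expand ℂ 2 p) := hcop.symm.map (expand ℂ 2).toRingHom
    apply h1.dvd_of_dvd_mul_right
    exact ⟨(1 - X ^ 2) ^ 2 * p - (1 + C c * X * (1 - X ^ 2)) * q, by linear_combination -E⟩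
  obtain ⟨t, ht⟩ := aux_denom q hq hd
  have ht2 : expand ℂ 2 q * expand ℂ 2 t = X ^ 2 * (X ^ 2 - 1) := by
    rw [← map_mul, ← ht]; simp
  have E2 : (X ^ 2 * (X - 1) ^ 2 * (X + 1)) * ((X - 1) * (X + 1) ^ 2 * (p * t)) =
      (X ^ 2 * (X - 1) ^ 2 * (X + 1)) *
        (-(expand ℂ 2 (p * t)) + (1 + C c * X * (1 - X ^ 2)) * X) := by
    rw [map_mul]
    linear_combination t * expand ℂ 2 t * E
      - (1 - X ^ 2) ^ 2 * p * t * ht2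
      - X * (1 - X ^ 2) * expand ℂ 2 p * expand ℂ 2 t * ht
      + (1 + C c * X * (1 - X ^ 2)) * q * t * ht2
      - (1 + C c * X * (1 - X ^ 2)) * (X ^ 2 * (X ^ 2 - 1)) * ht
  have hne : (X ^ 2 * (X - 1) ^ 2 * (X + 1) : ℂ[X]) ≠ 0 := by
    have hx : (X + 1 : ℂ[X]) ≠ 0 := by simpa using X_sub_C_ne_zero (-1 : ℂ)
    have hx' : (X - 1 : ℂ[X]) ≠ 0 := by simpa using X_sub_C_ne_zero (1 : ℂ)
    exact mul_ne_zero (mul_ne_zero (pow_ne_zero _ X_ne_zero) (pow_ne_zero _ hx')) hx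
  have E3 := mul_left_cancel₀ hne E2
  have e1 := congrArg (Polynomial.eval 1) E3
  have e2 := congrArg (Polynomial.eval (-1)) E3
  simp only [eval_mul, eval_sub, eval_add, eval_neg, eval_pow, eval_X, eval_one, expand_eval,
    eval_C] at e1 e2
  norm_num at e1 e2
  have : (2 : ℂ) = 0 := by linear_combination - e1 + e2
  norm_num at this

open Polynomial in
lemma aux_no_rat' (c : ℚ) (p q : ℚ[X]) (hq : q ≠ 0)
    (E : (1 - X ^ 2) ^ 2 * p * expand ℚ 2 q = X * (1 - X ^ 2) * expand ℚ 2 p * q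
      + (1 + C c * X * (1 - X ^ 2)) * q * expand ℚ 2 q) : False := by
  obtain ⟨g, p', q', hpq, hp, hq'⟩ : ∃ g p' q' : ℚ[X], IsCoprime p' q' ∧
      p = g * p' ∧ q = g * q' := by
    obtain ⟨p', hp'⟩ := EuclideanDomain.gcd_dvd_left p q
    obtain ⟨q', hq'⟩ := EuclideanDomain.gcd_dvd_right p q
    have hb := EuclideanDomain.gcd_eq_gcd_ab p q
    have hg : EuclideanDomain.gcd p q ≠ 0 := fun h => hq (by rw [hq', h, zero_mul])
    refine ⟨EuclideanDomain.gcd p q, p', q', ?_, hp', hq'⟩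
    refine ⟨EuclideanDomain.gcdA p q, EuclideanDomain.gcdB p q, ?_⟩
    apply mul_left_cancel₀ hg
    linear_combination -hb - EuclideanDomain.gcdA p q * hp' - EuclideanDomain.gcdB p q * hq'
  subst hp hq'
  have hg : g ≠ 0 := left_ne_zero_of_mul hq
  have hq0 : q' ≠ 0 := right_ne_zero_of_mul hq
  have hg2 : expand ℚ 2 g ≠ 0 := (expand_ne_zero two_pos).2 hg
  have E2 : (1 - X ^ 2) ^ 2 * p' * expand ℚ 2 q' = X * (1 - X ^ 2) * expand ℚ 2 p' * q'
      + (1 + C c * X * (1 - X ^ 2)) * q' * expand ℚ 2 q' := by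
    apply mul_left_cancel₀ (mul_ne_zero hg hg2)
    rw [map_mul, map_mul] at E
    linear_combination E
  have hinj : Function.Injective (algebraMap ℚ ℂ) := (algebraMap ℚ ℂ).injective
  refine aux_no_rat (algebraMap ℚ ℂ c) (p'.map (algebraMap ℚ ℂ)) (q'.map (algebraMap ℚ ℂ))
    ((Polynomial.map_ne_zero_iff hinj).2 hq0) (hpq.map (mapRingHom (algebraMap ℚ ℂ))) ?_
  have := congrArg (Polynomial.map (algebraMap ℚ ℂ)) E2
  simpa only [Polynomial.map_mul, Polynomial.map_add, Polynomial.map_sub, Polynomial.map_pow,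
    Polynomial.map_X, Polynomial.map_one, Polynomial.map_C, map_expand] using this

open Polynomial in
lemma aux_taylor {R : Type*} [CommRing R] (f : R[X]) (r : R) (d : ℕ) (hf : f.natDegree ≤ d + 1) :
    (taylor r f).coeff d = f.coeff d + (d + 1) * f.coeff (d + 1) * r := by
  rw [taylor_coeff, eval_eq_sum_range' (n := 2)]
  · simp [Finset.sum_range_succ, hasseDeriv_coeff, add_comm 1 d, Nat.choose_succ_self_right]
  · have := natDegree_hasseDeriv_le f d
    omega

lemma aux_expand_coe (p : Polynomial ℚ) :
    PowerSeries.expand 2 two_ne_zero (p : PowerSeries ℚ) =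
      ((Polynomial.expand ℚ 2 p : Polynomial ℚ) : PowerSeries ℚ) := by
  have : (PowerSeries.expand 2 two_ne_zero).comp (Polynomial.coeToPowerSeries.algHom (R := ℚ) ℚ) =
      (Polynomial.coeToPowerSeries.algHom (R := ℚ) ℚ).comp (Polynomial.expand ℚ 2) := by
    apply Polynomial.algHom_ext
    simp [Polynomial.coeToPowerSeries.algHom_apply]
  simpa [Polynomial.coeToPowerSeries.algHom_apply] using DFunLike.congr_fun this p

lemma aux_algebraMap (p : Polynomial ℚ) :
    algebraMap (Polynomial ℚ) (PowerSeries ℚ) p = (p : PowerSeries ℚ) := by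
  simp [PowerSeries.algebraMap_apply']

open Polynomial in
lemma aux_transc (c : ℚ) (H : PowerSeries ℚ)
    (FE : algebraMap ℚ[X] (PowerSeries ℚ) ((1 - X ^ 2) ^ 2) * H =
      algebraMap ℚ[X] (PowerSeries ℚ) (1 + C c * X * (1 - X ^ 2)) +
      algebraMap ℚ[X] (PowerSeries ℚ) (X * (1 - X ^ 2)) * PowerSeries.expand 2 two_ne_zero H) :
    Transcendental ℚ[X] H := by
  intro halg
  have hinj : Function.Injective (algebraMap ℚ[X] (PowerSeries ℚ)) := by
    intro a c h
    rw [aux_algebraMap, aux_algebraMap] at h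
    exact Polynomial.coe_injective ℚ h
  -- a nonzero polynomial of minimal degree
  have hex : ∃ n : ℕ, ∃ P : ℚ[X][X], P ≠ 0 ∧ aeval H P = 0 ∧ P.natDegree = n := by
    obtain ⟨P, h1, h2⟩ := halg
    exact ⟨_, P, h1, h2, rfl⟩
  classical
  obtain ⟨P, hP0, hPH, hPd⟩ := Nat.find_spec hex
  have hmin : ∀ Q : ℚ[X][X], aeval H Q = 0 → Q.natDegree < P.natDegree → Q = 0 := by
    intro Q hQ hlt
    by_contra hQ0
    rw [hPd] at hlt
    exact Nat.find_min hex hlt ⟨Q, hQ0, hQ, rfl⟩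
  clear hPd
  obtain ⟨d, hd⟩ : ∃ d, P.natDegree = d + 1 := by
    apply Nat.exists_eq_succ_of_ne_zero
    intro h0
    rw [eq_C_of_natDegree_eq_zero h0, aeval_C, map_eq_zero_iff _ hinj] at hPH
    apply hP0
    rw [eq_C_of_natDegree_eq_zero h0, hPH, C_0]
  set D : ℚ[X] := (1 - X ^ 2) ^ 2 with hD
  set N : ℚ[X] := 1 + C c * X * (1 - X ^ 2) with hN
  set B : ℚ[X] := X * (1 - X ^ 2) with hB
  have hx1 : (1 - X ^ 2 : ℚ[X]) ≠ 0 := by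
    intro h
    have := congrArg (Polynomial.eval 0) h
    simp at this
  have hD0 : D ≠ 0 := pow_ne_zero _ hx1
  let φ : ℚ[X] →+* ℚ[X] := (expand ℚ 2).toRingHom
  have hφ : ∀ a, φ a = expand ℚ 2 a := fun a => rfl
  have hφinj : Function.Injective φ := expand_injective two_pos
  let a := P.coeff (d + 1)
  let a1 := P.coeff d
  have ha0 : a ≠ 0 := by
    have : P.leadingCoeff ≠ 0 := leadingCoeff_ne_zero.2 hP0
    rwa [leadingCoeff, hd] at this
  -- the two polynomials killing `D * H`
  let S1 := P.scaleRoots D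
  have hS1 : aeval (algebraMap ℚ[X] (PowerSeries ℚ) D * H) S1 = 0 := scaleRoots_aeval_eq_zero hPH
  let S0 := (P.map φ).scaleRoots B
  have hPφ : aeval (PowerSeries.expand 2 two_ne_zero H) (P.map φ) = 0 := by
    have h1 := congrArg (PowerSeries.expand 2 two_ne_zero (R := ℚ)) hPH
    rw [map_zero, aeval_def, ← AlgHom.coe_toRingHom, hom_eval₂] at h1
    rw [aeval_def, eval₂_map]
    have h2 : (algebraMap ℚ[X] (PowerSeries ℚ)).comp φ =
        ((PowerSeries.expand 2 two_ne_zero : PowerSeries ℚ →ₐ[ℚ] PowerSeries ℚ) :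
          PowerSeries ℚ →+* PowerSeries ℚ).comp (algebraMap ℚ[X] (PowerSeries ℚ)) := by
      refine RingHom.ext fun x => ?_
      simp only [RingHom.comp_apply, hφ, aux_algebraMap]
      exact (aux_expand_coe x).symm
    rw [h2]
    exact h1
  have hS0 : aeval (algebraMap ℚ[X] (PowerSeries ℚ) B * PowerSeries.expand 2 two_ne_zero H) S0 = 0 :=
    scaleRoots_aeval_eq_zero hPφ
  let S2 := taylor (-N) S0
  have hS2 : aeval (algebraMap ℚ[X] (PowerSeries ℚ) D * H) S2 = 0 := by
    change aeval _ (S0.comp (X + C (-N))) = 0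
    rw [aeval_comp, ← hS0]
    congr 2
    rw [FE]
    simp
  have hdφ : (P.map φ).natDegree = d + 1 := by
    rw [natDegree_map_eq_of_injective hφinj, hd]
  have hS0d : S0.natDegree = d + 1 := by rw [natDegree_scaleRoots, hdφ]
  have hS1d : S1.natDegree = d + 1 := by rw [natDegree_scaleRoots, hd]
  have hS2d : S2.natDegree = d + 1 := by rw [natDegree_taylor, hS0d]
  have cS0 : S0.coeff (d + 1) = φ a := by simp [S0, coeff_scaleRoots, hdφ, a]
  have cS0' : S0.coeff d = φ a1 * B := by simp [S0, coeff_scaleRoots, hdφ, a1]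
  have cS1 : S1.coeff (d + 1) = a := by simp [S1, coeff_scaleRoots, hd, a]
  have cS1' : S1.coeff d = a1 * D := by simp [S1, coeff_scaleRoots, hd, a1]
  have cS2 : S2.coeff (d + 1) = φ a := by
    have : S2.coeff (d + 1) = S2.leadingCoeff := by rw [leadingCoeff, hS2d]
    rw [this, leadingCoeff_taylor, leadingCoeff, hS0d, cS0]
  have cS2' : S2.coeff d = φ a1 * B + (d + 1) * φ a * (-N) := by
    rw [aux_taylor _ _ _ hS0d.le, cS0, cS0']
  let T := C a * S2 - C (φ a) * S1
  have hT : aeval (algebraMap ℚ[X] (PowerSeries ℚ) D * H) T = 0 := by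
    simp [T, hS1, hS2]
  have hTd : T.natDegree < d + 1 := by
    have h1 : T.natDegree ≤ d := by
      rw [natDegree_le_iff_coeff_eq_zero]
      intro n hn
      rcases Nat.lt_or_ge (d + 1) n with h | h
      · simp only [T, coeff_sub, coeff_C_mul]
        rw [coeff_eq_zero_of_natDegree_lt (by omega), coeff_eq_zero_of_natDegree_lt (by omega)]
        simp
      · obtain rfl : n = d + 1 := by omega
        simp only [T, coeff_sub, coeff_C_mul, cS1, cS2]
        ring
    omega
  have hT0 : T = 0 := by
    have h1 : T.comp (C D * X) = 0 := by
      apply hmin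
      · rw [aeval_comp]
        simpa using hT
      · rw [hd]
        refine lt_of_le_of_lt natDegree_comp_le ?_
        have : (C D * X : ℚ[X][X]).natDegree = 1 := natDegree_C_mul_X D hD0
        rw [this]; omega
    rcases comp_eq_zero_iff.1 h1 with h | ⟨_, h⟩
    · exact h
    · exfalso
      have := congrArg (fun f => Polynomial.coeff f 1) h
      simp [coeff_C] at this
      exact hD0 this
  have hcoef : T.coeff d = 0 := by rw [hT0]; simp
  simp only [T, coeff_sub, coeff_C_mul, cS1', cS2', hφ] at hcoef
  refine aux_no_rat' c (-a1) ((d + 1 : ℕ) * a)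
    (mul_ne_zero (by exact_mod_cast Nat.succ_ne_zero d) ha0) ?_
  rw [map_mul, map_natCast, map_neg]
  push_cast
  rw [← hD, ← hB, ← hN]
  linear_combination ((d : ℚ[X]) + 1) * hcoef

/-- For `b ≥ 2`, the generating function `H_b(X) = ∑ h_{1,b}(n) Xⁿ`,
viewed as an element of `ℚ[[X]]`, is transcendental over the subring `ℚ[X]` of
polynomials (with its canonical embedding into `ℚ[[X]]`). -/
theorem stmt13 (b : ℕ) (hb : 2 ≤ b) (h : ℤ → ℕ)
    (hneg : ∀ n : ℤ, n ≤ 0 → h n = 1) (hone : h 1 = b)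
    (hrec : ∀ n : ℤ, 2 ≤ n → h n = h (n - (h (n - 1) : ℤ)) + h (n - 2)) :
    Transcendental (Polynomial ℚ)
      (PowerSeries.mk (fun n : ℕ => (h n : ℚ)) : PowerSeries ℚ) := by
  have h0 : h 0 = 1 := hneg 0 le_rfl
  -- even values, and odd values are large
  have main : ∀ k : ℕ, h (2 * k) = k + 1 ∧ 2 * k + 2 ≤ h (2 * k + 1) ∧
      h (2 * (k + 1) + 1) = h (k + 1) + h (2 * k + 1) := by
    intro k
    induction k using Nat.strong_induction_on with
    | _ k ih =>
    have e : h (2 * (k : ℤ)) = k + 1 := by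
      rcases k with _ | k
      · simpa using h0
      · obtain ⟨ih1, ih2, -⟩ := ih k (Nat.lt_succ_self k)
        rw [hrec _ (by push_cast; omega)]
        have e1 : (2 * ((k + 1 : ℕ) : ℤ)) - 1 = 2 * k + 1 := by push_cast; ring
        have e2 : (2 * ((k + 1 : ℕ) : ℤ)) - 2 = 2 * k := by push_cast; ring
        rw [e1, e2, ih1, hneg _ (by push_cast; omega)]
        ring
    have o : 2 * k + 2 ≤ h (2 * (k : ℤ) + 1) := by
      rcases k with _ | k
      · simpa [hone] using hb
      · obtain ⟨ih1, ih2, ih3⟩ := ih k (Nat.lt_succ_self k)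
        push_cast
        rw [ih3]
        have : 2 ≤ h ((k : ℤ) + 1) := by
          rcases Nat.even_or_odd' (k + 1) with ⟨j, hj | hj⟩
          · have hj' : (k : ℤ) + 1 = 2 * j := by exact_mod_cast hj
            rw [hj']
            by_cases hk : j < k + 1
            · rw [(ih j hk).1]; omega
            · omega
          · have hj' : (k : ℤ) + 1 = 2 * j + 1 := by exact_mod_cast hj
            rw [hj']
            have := (ih j (by omega)).2.1
            omega
        omega
    refine ⟨e, o, ?_⟩
    have e' : h (2 * ((k : ℤ) + 1)) = k + 2 := by
      rw [hrec _ (by omega)]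
      have e1 : (2 * ((k : ℤ) + 1)) - 1 = 2 * k + 1 := by ring
      have e2 : (2 * ((k : ℤ) + 1)) - 2 = 2 * k := by ring
      rw [e1, e2, e, hneg _ (by omega)]
      ring
    rw [hrec _ (by omega)]
    have e1 : 2 * ((k : ℤ) + 1) + 1 - 1 = 2 * (k + 1) := by ring
    have e2 : 2 * ((k : ℤ) + 1) + 1 - 2 = 2 * k + 1 := by ring
    rw [e1, e', e2]
    congr 2
    push_cast
    ring
  set H : PowerSeries ℚ := PowerSeries.mk (fun n : ℕ => (h n : ℚ)) with hH
  let V : PowerSeries ℚ := PowerSeries.mk (fun n : ℕ => (n : ℚ) + 1)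
  let U : PowerSeries ℚ := PowerSeries.mk (fun n : ℕ => (h (2 * n + 1) : ℚ))
  have hU : (1 - PowerSeries.X) * U = PowerSeries.C ((b : ℚ) - 1) + H := by
    ext n
    rw [sub_mul, one_mul, map_sub]
    rcases n with _ | n
    · simp [U, H, hone, h0]
    · rw [PowerSeries.coeff_succ_X_mul, map_add, PowerSeries.coeff_C]
      simp only [U, H, PowerSeries.coeff_mk]
      push_cast
      rw [(main n).2.2]
      simp
  have hV1 : (1 - PowerSeries.X) * V = PowerSeries.mk 1 := by
    ext n
    rw [sub_mul, one_mul, map_sub]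
    rcases n with _ | n
    · simp [V]
    · rw [PowerSeries.coeff_succ_X_mul]
      simp [V]
  have hV : (1 - PowerSeries.X) ^ 2 * V = 1 := by
    rw [pow_two, mul_assoc, hV1, mul_comm]
    exact PowerSeries.mk_one_mul_one_sub_eq_one ℚ
  have hHd : H = PowerSeries.expand 2 two_ne_zero V +
      PowerSeries.X * PowerSeries.expand 2 two_ne_zero U := by
    ext n
    rw [map_add]
    rcases Nat.even_or_odd' n with ⟨k, rfl | rfl⟩
    · rw [PowerSeries.coeff_expand_mul]
      have : PowerSeries.coeff (2 * k)
          (PowerSeries.X * PowerSeries.expand 2 two_ne_zero U) = 0 := by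
        rcases k with _ | k
        · simp
        · rw [show 2 * (k + 1) = (2 * k + 1) + 1 by ring, PowerSeries.coeff_succ_X_mul,
            PowerSeries.coeff_expand_of_not_dvd _ _ _ (by omega)]
      rw [this]
      simp [H, V, (main k).1]
    · rw [PowerSeries.coeff_succ_X_mul, PowerSeries.coeff_expand_mul,
        PowerSeries.coeff_expand_of_not_dvd _ _ _ (by omega)]
      simp [H, U]
  have hU2 := congrArg (PowerSeries.expand 2 two_ne_zero (R := ℚ)) hU
  have hV2 := congrArg (PowerSeries.expand 2 two_ne_zero (R := ℚ)) hV
  simp only [map_mul, map_sub, map_add, map_one, map_pow, PowerSeries.expand_X,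
    PowerSeries.expand_C] at hU2 hV2
  apply aux_transc ((b : ℚ) - 1)
  simp only [aux_algebraMap, Polynomial.coe_mul, Polynomial.coe_add, Polynomial.coe_sub,
    Polynomial.coe_pow, Polynomial.coe_X, Polynomial.coe_one, Polynomial.coe_C, map_sub, map_one]
  linear_combination (1 - PowerSeries.X ^ 2) ^ 2 * hHd + hV2
    + PowerSeries.X * (1 - PowerSeries.X ^ 2) * hU2
end
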